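/- Under the standing assumptions (unique CAID P* with full support, and C_k > C for k = 1,2), there exists a unique constant η ∈ (0,1) such that η·∇I₁(v) + (1−η)·∇I₂(v) = 0 for every vector v ∈ ℝ₀^{𝒳} (i.e., every v ∈ ℝ^{𝒳} whose entries sum to zero). -/

import Mathlib

open Finset

noncomputable section

variable {𝒳 𝒴 : Type*} [Fintype 𝒳] [Fintype 𝒴]

/-- `P` is a probability distribution on the finite alphabet `𝒳`. -/
def IsDist (P : 𝒳 → ℝ) : Prop := (∀ x, 0 ≤ P x) ∧ ∑ x, P x = 1

/-- The output distribution `PW` induced by input distribution `P` and channel `W`. -/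
def outDist (P : 𝒳 → ℝ) (W : 𝒳 → 𝒴 → ℝ) (y : 𝒴) : ℝ := ∑ x, P x * W x y

/-- The mutual information `I(P, W)` (natural logarithm). -/
def mutInfo (P : 𝒳 → ℝ) (W : 𝒳 → 𝒴 → ℝ) : ℝ :=
  ∑ x, ∑ y, P x * W x y * Real.log (W x y / outDist P W y)

/-- Relative entropy (KL divergence) between two pmfs on a finite alphabet. -/
def relEnt (p q : 𝒴 → ℝ) : ℝ := ∑ y, p y * Real.log (p y / q y)

/-- Directional derivative `∇I_k(v)` of the mutual information at `P*` along `v`. -/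
def gradI (Pstar : 𝒳 → ℝ) (W : 𝒳 → 𝒴 → ℝ) (v : 𝒳 → ℝ) : ℝ :=
  ∑ x, v x * relEnt (W x) (outDist Pstar W)

open Filter Topology

lemma outDist_nonneg {P : 𝒳 → ℝ} {W : 𝒳 → 𝒴 → ℝ} (hP : ∀ x, 0 ≤ P x)
    (hW : ∀ x y, 0 ≤ W x y) (y : 𝒴) : 0 ≤ outDist P W y :=
  Finset.sum_nonneg fun x _ => mul_nonneg (hP x) (hW x y)

lemma outDist_pos {P : 𝒳 → ℝ} {W : 𝒳 → 𝒴 → ℝ} (hP : ∀ x, 0 ≤ P x)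
    (hW : ∀ x y, 0 ≤ W x y) {x : 𝒳} {y : 𝒴} (h : 0 < P x * W x y) : 0 < outDist P W y :=
  h.trans_le (Finset.single_le_sum (f := fun x => P x * W x y)
    (fun x _ => mul_nonneg (hP x) (hW x y)) (Finset.mem_univ x))

lemma sum_outDist {P : 𝒳 → ℝ} {W : 𝒳 → 𝒴 → ℝ} (hW : ∀ x, ∑ y, W x y = 1) :
    ∑ y, outDist P W y = ∑ x, P x := by
  unfold outDist
  rw [Finset.sum_comm]
  simp [← Finset.mul_sum, hW]

/-- The support of the output of a fully supported input contains every output support. -/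
lemma outDist_eq_zero_of_pos {P : 𝒳 → ℝ} {W : 𝒳 → 𝒴 → ℝ} (hP : ∀ x, 0 < P x)
    (hW : ∀ x y, 0 ≤ W x y) (Q : 𝒳 → ℝ) {y : 𝒴} (h : outDist P W y = 0) :
    outDist Q W y = 0 := by
  have hWy : ∀ x, W x y = 0 := fun x => by
    by_contra hne
    exact (outDist_pos (fun x => (hP x).le) hW
      (mul_pos (hP x) (lt_of_le_of_ne (hW x y) (Ne.symm hne)))).ne' h
  simp [outDist, hWy]

/-- The compensation identity for mutual information. -/
lemma mutInfo_eq_sub_relEnt {P Q : 𝒳 → ℝ} {W : 𝒳 → 𝒴 → ℝ} (hP : ∀ x, 0 < P x)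
    (hQ : ∀ x, 0 ≤ Q x) (hW : ∀ x y, 0 ≤ W x y) :
    mutInfo Q W = gradI P W Q - relEnt (outDist Q W) (outDist P W) := by
  have key : ∀ x y, Q x * W x y * Real.log (W x y / outDist Q W y) =
      Q x * (W x y * Real.log (W x y / outDist P W y)) -
        Q x * W x y * Real.log (outDist Q W y / outDist P W y) := by
    intro x y
    rcases (mul_nonneg (hQ x) (hW x y)).eq_or_lt with h | h
    · rw [← mul_assoc, ← h]; simp
    · have hWpos : 0 < W x y := pos_of_mul_pos_right h (hQ x)
      have hq := outDist_pos hQ hW h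
      have hp := outDist_pos (fun x => (hP x).le) hW (mul_pos (hP x) hWpos)
      rw [Real.log_div hWpos.ne' hq.ne', Real.log_div hWpos.ne' hp.ne',
        Real.log_div hq.ne' hp.ne']
      ring
  have hrel : relEnt (outDist Q W) (outDist P W) =
      ∑ x, ∑ y, Q x * W x y * Real.log (outDist Q W y / outDist P W y) := by
    rw [Finset.sum_comm]
    simp only [relEnt, ← Finset.sum_mul]
    rfl
  rw [hrel]
  simp only [mutInfo, gradI, relEnt, key, Finset.mul_sum, Finset.sum_sub_distrib]

lemma relEnt_nonneg {p q : 𝒴 → ℝ} (hp : ∀ y, 0 ≤ p y) (hq : ∀ y, 0 ≤ q y)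
    (hac : ∀ y, q y = 0 → p y = 0) (hsum : ∑ y, p y = ∑ y, q y) : 0 ≤ relEnt p q := by
  have h : ∑ y, (p y - q y) ≤ relEnt p q := Finset.sum_le_sum fun y _ => by
    rcases (hp y).eq_or_lt with h | h
    · rw [← h]; simpa using hq y
    · have hqy : 0 < q y := lt_of_le_of_ne (hq y) fun h0 => h.ne' (hac y h0.symm)
      have h1 := Real.one_sub_inv_le_log_of_pos (div_pos h hqy)
      have h2 := mul_le_mul_of_nonneg_left h1 h.le
      have h3 : p y * (1 - (p y / q y)⁻¹) = p y - q y := by field_simp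
      linarith
  rwa [Finset.sum_sub_distrib, hsum, sub_self] at h

/-- Relative entropy is bounded by the chi-squared divergence. -/
lemma relEnt_le_chiSq {p q : 𝒴 → ℝ} (hp : ∀ y, 0 ≤ p y) (hq : ∀ y, 0 ≤ q y)
    (hac : ∀ y, q y = 0 → p y = 0) (hsum : ∑ y, p y = ∑ y, q y) :
    relEnt p q ≤ ∑ y, (p y - q y) ^ 2 / q y := by
  have h : relEnt p q ≤ ∑ y, ((p y - q y) ^ 2 / q y + (p y - q y)) :=
    Finset.sum_le_sum fun y _ => by
      rcases (hq y).eq_or_lt with h | h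
      · rw [hac y h.symm, ← h]; simp
      · rcases (hp y).eq_or_lt with h' | h'
        · rw [← h']
          apply le_of_eq
          field_simp
          ring
        · have h1 := Real.log_le_sub_one_of_pos (div_pos h' h)
          have h2 := mul_le_mul_of_nonneg_left h1 h'.le
          have h3 : p y * (p y / q y - 1) = (p y - q y) ^ 2 / q y + (p y - q y) := by
            field_simp
            ring
          linarith
  rwa [Finset.sum_add_distrib, Finset.sum_sub_distrib, hsum, sub_self, add_zero] at h

lemma gradI_add (P : 𝒳 → ℝ) (W : 𝒳 → 𝒴 → ℝ) (u v : 𝒳 → ℝ) :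
    gradI P W (u + v) = gradI P W u + gradI P W v := by
  simp [gradI, add_mul, Finset.sum_add_distrib]

lemma gradI_smul (P : 𝒳 → ℝ) (W : 𝒳 → 𝒴 → ℝ) (c : ℝ) (v : 𝒳 → ℝ) :
    gradI P W (c • v) = c * gradI P W v := by
  simp [gradI, mul_assoc, Finset.mul_sum]

lemma gradI_self {P : 𝒳 → ℝ} {W : 𝒳 → 𝒴 → ℝ} (hP : ∀ x, 0 < P x)
    (hW : ∀ x y, 0 ≤ W x y) : gradI P W P = mutInfo P W := by
  rw [mutInfo_eq_sub_relEnt hP (fun x => (hP x).le) hW, eq_comm, sub_eq_self]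
  refine Finset.sum_eq_zero fun y _ => ?_
  rcases eq_or_ne (outDist P W y) 0 with h | h
  · simp [h]
  · simp [div_self h]

/-- The first-order upper bound expressing concavity of mutual information. -/
lemma mutInfo_le_add_gradI {P Q : 𝒳 → ℝ} {W : 𝒳 → 𝒴 → ℝ} (hP : IsDist P)
    (hPpos : ∀ x, 0 < P x) (hQ : IsDist Q) (hW : ∀ x y, 0 ≤ W x y)
    (hWsum : ∀ x, ∑ y, W x y = 1) :
    mutInfo Q W ≤ mutInfo P W + gradI P W (Q - P) := by
  have h1 := mutInfo_eq_sub_relEnt hPpos hQ.1 hW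
  have h2 := gradI_add P W P (Q - P)
  rw [add_sub_cancel, gradI_self hPpos hW] at h2
  have h3 : 0 ≤ relEnt (outDist Q W) (outDist P W) :=
    relEnt_nonneg (outDist_nonneg hQ.1 hW) (outDist_nonneg hP.1 hW)
      (fun _ => outDist_eq_zero_of_pos hPpos hW Q)
      (by rw [sum_outDist hWsum, sum_outDist hWsum, hP.2, hQ.2])
  linarith

lemma mutInfo_add_smul_ge {P v : 𝒳 → ℝ} {W : 𝒳 → 𝒴 → ℝ} {t : ℝ} (hP : IsDist P)
    (hPpos : ∀ x, 0 < P x) (hQ : IsDist (P + t • v)) (hW : ∀ x y, 0 ≤ W x y)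
    (hWsum : ∀ x, ∑ y, W x y = 1) :
    mutInfo P W + t * gradI P W v - t ^ 2 * ∑ y, outDist v W y ^ 2 / outDist P W y ≤
      mutInfo (P + t • v) W := by
  have h1 := mutInfo_eq_sub_relEnt hPpos hQ.1 hW
  rw [gradI_add, gradI_smul, gradI_self hPpos hW] at h1
  have h3 := relEnt_le_chiSq (outDist_nonneg hQ.1 hW) (outDist_nonneg hP.1 hW)
    (fun _ => outDist_eq_zero_of_pos hPpos hW (P + t • v))
    (by rw [sum_outDist hWsum, sum_outDist hWsum, hP.2, hQ.2])
  have h4 : ∀ y, outDist (P + t • v) W y - outDist P W y = t * outDist v W y := fun y => by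
    simp [outDist, add_mul, Finset.sum_add_distrib, Finset.mul_sum, mul_assoc]
  simp only [h4, mul_pow, mul_div_assoc, ← Finset.mul_sum] at h3
  linarith

lemma eventually_isDist_add_smul {P v : 𝒳 → ℝ} (hP : IsDist P) (hPpos : ∀ x, 0 < P x)
    (hv : ∑ x, v x = 0) : ∀ᶠ t : ℝ in 𝓝[>] 0, IsDist (P + t • v) := by
  have h : ∀ᶠ t : ℝ in 𝓝[>] 0, ∀ x, 0 < P x + t * v x := by
    refine eventually_all.2 fun x => nhdsWithin_le_nhds ?_
    have hc : ContinuousAt (fun t : ℝ => P x + t * v x) 0 := by fun_prop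
    exact hc.eventually (lt_mem_nhds (by simpa using hPpos x))
  filter_upwards [h] with t ht
  refine ⟨fun x => by simpa using (ht x).le, ?_⟩
  simp [Finset.sum_add_distrib, ← Finset.mul_sum, hv, hP.2]

/-- Along an ascent direction, mutual information eventually exceeds any value it does not start
below. -/
lemma eventually_lt_mutInfo {P v : 𝒳 → ℝ} {W : 𝒳 → 𝒴 → ℝ} {c : ℝ} (hP : IsDist P)
    (hPpos : ∀ x, 0 < P x) (hv : ∑ x, v x = 0) (hW : ∀ x y, 0 ≤ W x y)
    (hWsum : ∀ x, ∑ y, W x y = 1)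
    (hc : c < mutInfo P W ∨ c ≤ mutInfo P W ∧ 0 < gradI P W v) :
    ∀ᶠ t : ℝ in 𝓝[>] 0, c < mutInfo (P + t • v) W := by
  set K := ∑ y, outDist v W y ^ 2 / outDist P W y
  have hlow : ∀ᶠ t : ℝ in 𝓝[>] 0, c < mutInfo P W + t * gradI P W v - t ^ 2 * K := by
    rcases hc with h | ⟨h, hg⟩
    · have hcont : ContinuousAt
          (fun t : ℝ => mutInfo P W + t * gradI P W v - t ^ 2 * K) 0 := by fun_prop
      exact nhdsWithin_le_nhds (hcont.eventually (lt_mem_nhds (by simpa using h)))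
    · have hcont : ContinuousAt (fun t : ℝ => gradI P W v - t * K) 0 := by fun_prop
      have hpos : ∀ᶠ t : ℝ in 𝓝[>] 0, 0 < gradI P W v - t * K :=
        nhdsWithin_le_nhds (hcont.eventually (lt_mem_nhds (by simpa using hg)))
      filter_upwards [hpos, self_mem_nhdsWithin] with t ht ht0
      have := mul_pos (Set.mem_Ioi.1 ht0) ht
      nlinarith
  filter_upwards [hlow, eventually_isDist_add_smul hP hPpos hv] with t ht hQ
  exact ht.trans_le (mutInfo_add_smul_ge hP hPpos hQ hW hWsum)

/-- **Lemma 1**: there is a unique `η ∈ (0,1)` with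
`η ∇I₁(v) + (1-η) ∇I₂(v) = 0` for all `v` with entries summing to zero. -/
theorem lemma1_unique_eta (W1 W2 : 𝒳 → 𝒴 → ℝ)
    (hW1 : ∀ x y, 0 ≤ W1 x y) (hW1sum : ∀ x, ∑ y, W1 x y = 1)
    (hW2 : ∀ x y, 0 ≤ W2 x y) (hW2sum : ∀ x, ∑ y, W2 x y = 1)
    (Pstar : 𝒳 → ℝ) (C C1 C2 : ℝ)
    (hPstar : IsDist Pstar) (hPpos : ∀ x, 0 < Pstar x)
    (hCach : min (mutInfo Pstar W1) (mutInfo Pstar W2) = C)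
    (hCmax : ∀ P, IsDist P → min (mutInfo P W1) (mutInfo P W2) ≤ C)
    (hUniq : ∀ P, IsDist P → min (mutInfo P W1) (mutInfo P W2) = C → P = Pstar)
    (hC1 : IsLUB {r | ∃ P, IsDist P ∧ r = mutInfo P W1} C1)
    (hC2 : IsLUB {r | ∃ P, IsDist P ∧ r = mutInfo P W2} C2)
    (hC1gt : C < C1) (hC2gt : C < C2) :
    ∃! η : ℝ, η ∈ Set.Ioo (0 : ℝ) 1 ∧
      ∀ v : 𝒳 → ℝ, ∑ x, v x = 0 →
        η * gradI Pstar W1 v + (1 - η) * gradI Pstar W2 v = 0 := by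
  have hle1 : C ≤ mutInfo Pstar W1 := hCach ▸ min_le_left _ _
  have hle2 : C ≤ mutInfo Pstar W2 := hCach ▸ min_le_right _ _
  have no_ascent : ∀ v : 𝒳 → ℝ, ∑ x, v x = 0 →
      (C < mutInfo Pstar W1 ∨ 0 < gradI Pstar W1 v) →
      (C < mutInfo Pstar W2 ∨ 0 < gradI Pstar W2 v) → False := by
    intro v hv h1 h2
    have e1 := eventually_lt_mutInfo hPstar hPpos hv hW1 hW1sum (h1.imp_right (And.intro hle1))
    have e2 := eventually_lt_mutInfo hPstar hPpos hv hW2 hW2sum (h2.imp_right (And.intro hle2))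
    obtain ⟨t, ht1, ht2, hQ⟩ :=
      (e1.and (e2.and (eventually_isDist_add_smul hPstar hPpos hv))).exists
    exact (lt_min ht1 ht2).not_ge (hCmax _ hQ)
  obtain ⟨_, ⟨Q1, hQ1, rfl⟩, hlt1⟩ := (lt_isLUB_iff hC1).1 hC1gt
  obtain ⟨_, ⟨Q2, hQ2, rfl⟩, hlt2⟩ := (lt_isLUB_iff hC2).1 hC2gt
  have ha : ∑ x, (Q1 - Pstar) x = 0 := by simp [Finset.sum_sub_distrib, hQ1.2, hPstar.2]
  have hb : ∑ x, (Q2 - Pstar) x = 0 := by simp [Finset.sum_sub_distrib, hQ2.2, hPstar.2]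
  have hup1 := mutInfo_le_add_gradI hPstar hPpos hQ1 hW1 hW1sum
  have hup2 := mutInfo_le_add_gradI hPstar hPpos hQ2 hW2 hW2sum
  generalize Q1 - Pstar = a at ha hup1
  generalize Q2 - Pstar = b at hb hup2
  have hor1 : C < mutInfo Pstar W1 ∨ 0 < gradI Pstar W1 a := by
    by_contra! h
    linarith [h.1, h.2]
  have hor2 : C < mutInfo Pstar W2 ∨ 0 < gradI Pstar W2 b := by
    by_contra! h
    linarith [h.1, h.2]
  have hn1 : ¬ C < mutInfo Pstar W1 := fun h => no_ascent b hb (Or.inl h) hor2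
  have hn2 : ¬ C < mutInfo Pstar W2 := fun h => no_ascent a ha hor1 (Or.inl h)
  have hga : 0 < gradI Pstar W1 a := hor1.resolve_left hn1
  have hgb : 0 < gradI Pstar W2 b := hor2.resolve_left hn2
  set r := gradI Pstar W2 a / gradI Pstar W1 a with hr
  have hprop : ∀ v : 𝒳 → ℝ, ∑ x, v x = 0 → gradI Pstar W2 v = r * gradI Pstar W1 v := by
    intro v hv
    by_contra hne
    set w := v + (-(gradI Pstar W1 v / gradI Pstar W1 a)) • a with hw
    have hw1 : gradI Pstar W1 w = 0 := by
      rw [hw, gradI_add, gradI_smul]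
      field_simp
      ring
    have hw2 : gradI Pstar W2 w ≠ 0 := by
      have : gradI Pstar W2 w = gradI Pstar W2 v - r * gradI Pstar W1 v := by
        rw [hw, gradI_add, gradI_smul, hr]
        field_simp
        ring
      rw [this]
      exact sub_ne_zero.2 hne
    have hws : ∑ x, w x = 0 := by
      simp [hw, Finset.sum_add_distrib, ← Finset.mul_sum, hv, ha]
    refine no_ascent (((1 - gradI Pstar W2 a) / gradI Pstar W2 w) • w + a) ?_ (Or.inr ?_)
      (Or.inr ?_)
    · simp [Finset.sum_add_distrib, ← Finset.mul_sum, hws, ha]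
    · rw [gradI_add, gradI_smul, hw1]
      simpa using hga
    · rw [gradI_add, gradI_smul, div_mul_cancel₀ _ hw2]
      simp
  have hrneg : r < 0 := by
    have h2 : gradI Pstar W2 a ≤ 0 := not_lt.1 fun h => no_ascent a ha hor1 (Or.inr h)
    refine lt_of_le_of_ne (div_nonpos_of_nonpos_of_nonneg h2 hga.le) fun h0 => ?_
    have := hprop b hb
    rw [h0, zero_mul] at this
    exact hgb.ne' this
  have h1r : 0 < 1 - r := by linarith
  refine ⟨-r / (1 - r), ⟨⟨div_pos (neg_pos.2 hrneg) h1r, ?_⟩, fun v hv => ?_⟩, ?_⟩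
  · rw [div_lt_one h1r]
    linarith
  · rw [hprop v hv]
    field_simp
    ring
  · rintro η ⟨-, hη⟩
    have h := hη a ha
    rw [hprop a ha] at h
    have h' : (η * (1 - r) + r) * gradI Pstar W1 a = 0 := by linear_combination h
    rw [eq_div_iff h1r.ne']
    linarith [(mul_eq_zero.1 h').resolve_right hga.ne']
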